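/- Under the covariate-adjusted pre-treatment factor model with Γα = β, the mean of the untreated potential outcome is identified by covariates and covariate-adjusted donor outcomes: E[Y0] = E[⟪C_Y, ξ_Y⟫ + ⟪W̃, α⟫], where W̃ = W − C_Wᵀ ξ_W. -/

import Mathlib

open MeasureTheory Matrix

/-- A function whose conditional expectation vanishes almost everywhere has integral zero. -/
theorem integral_eq_zero_of_condExp_ae_eq_zero {Ω : Type*} {m m₀ : MeasurableSpace Ω}
    {P : Measure Ω} [IsFiniteMeasure P] (hm : m ≤ m₀) {f : Ω → ℝ} (hf : P[f | m] =ᵐ[P] 0) :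
    ∫ ω, f ω ∂P = 0 := by
  rw [← integral_condExp hm, integral_congr_ae hf]
  simp

/-- Under the covariate-adjusted pre-treatment factor model with Γα = β, the mean
of the untreated potential outcome is identified by covariates and covariate-adjusted donor
outcomes: E[Y0] = E[⟪C_Y, ξ_Y⟫ + ⟪W̃, α⟫], where W̃ = W − C_Wᵀ ξ_W. -/
theorem sc_identification_Y0_covariates
    {Ω : Type*} [MeasurableSpace Ω] (P : Measure Ω) [IsProbabilityMeasure P]
    {F N pY pW : ℕ}
    (lam : Ω → Fin F → ℝ) (β : Fin F → ℝ) (Γ : Matrix (Fin F) (Fin N) ℝ)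
    (CY : Ω → Fin pY → ℝ) (ξY : Fin pY → ℝ)
    (CW : Ω → Fin pW → Fin N → ℝ) (ξW : Fin pW → ℝ)
    (Y0 : Ω → ℝ) (W : Ω → Fin N → ℝ) (εY : Ω → ℝ) (εW : Ω → Fin N → ℝ)
    (hlam : Measurable lam) (hCY : Measurable CY) (hCW : Measurable CW)
    (hY0 : ∀ ω, Y0 ω = lam ω ⬝ᵥ β + CY ω ⬝ᵥ ξY + εY ω)
    (hW : ∀ ω, W ω = Γ.transpose.mulVec (lam ω)
      + (Matrix.of (CW ω)).transpose.mulVec ξW + εW ω)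
    (hεY : P[εY |
      MeasurableSpace.comap (fun ω => (lam ω, CY ω, CW ω)) inferInstance] =ᵐ[P] 0)
    (hεW : ∀ i, P[(fun ω => εW ω i) |
      MeasurableSpace.comap (fun ω => (lam ω, CY ω, CW ω)) inferInstance] =ᵐ[P] 0)
    (hY0int : Integrable Y0 P) (hεYint : Integrable εY P)
    (hlamint : ∀ i, Integrable (fun ω => lam ω i) P)
    (hCYint : ∀ i, Integrable (fun ω => CY ω i) P)
    (hCWint : ∀ k i, Integrable (fun ω => CW ω k i) P)
    (hWint : ∀ i, Integrable (fun ω => W ω i) P)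
    (hεWint : ∀ i, Integrable (fun ω => εW ω i) P)
    (α : Fin N → ℝ) (hα : Γ.mulVec α = β) :
    ∫ ω, Y0 ω ∂P
      = ∫ ω, (CY ω ⬝ᵥ ξY + (W ω - (Matrix.of (CW ω)).transpose.mulVec ξW) ⬝ᵥ α) ∂P := by
  have hm := (hlam.prodMk (hCY.prodMk hCW)).comap_le
  have hεY0 : ∫ ω, εY ω ∂P = 0 := integral_eq_zero_of_condExp_ae_eq_zero hm hεY
  have hεW0 (i) : ∫ ω, εW ω i ∂P = 0 := integral_eq_zero_of_condExp_ae_eq_zero hm (hεW i)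
  have hεWα : Integrable (fun ω => εW ω ⬝ᵥ α) P :=
    integrable_finsetSum _ fun i _ => (hεWint i).mul_const (α i)
  have hεWα0 : ∫ ω, εW ω ⬝ᵥ α ∂P = 0 := by
    simp only [dotProduct]
    rw [integral_finsetSum _ fun i _ => (hεWint i).mul_const (α i)]
    simp [integral_mul_const, hεW0]
  have hdonor (ω : Ω) :
      CY ω ⬝ᵥ ξY + (W ω - (Matrix.of (CW ω)).transpose.mulVec ξW) ⬝ᵥ α
        = Y0 ω - εY ω + εW ω ⬝ᵥ α := by
    rw [hW, hY0, add_right_comm, add_sub_cancel_right, add_dotProduct, mulVec_transpose,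
      ← dotProduct_mulVec, hα]
    ring
  simp_rw [hdonor]
  rw [integral_add (hY0int.sub' hεYint) hεWα, integral_sub hY0int hεYint, hεY0, hεWα0,
    sub_zero, add_zero]
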